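/- Let (V, {f_{il}}) be a weak lower perfect space over k with a lower perfect basis B, and let i = ((i_k,l_k))_{k≥1} be a good index sequence. Then for every b ∈ B: b ∈ V^{≥i,d(i,b)}, and for every good sequence a of non-negative integers with b ∈ V^{≥i,a} one has a ≤ d(i,b). In other words, d(i,b) is the largest good sequence a such that b ∈ V^{≥i,a}. -/

import Mathlib

open Function

/-- A weak lower perfect space: a `P`-graded `k`-vector space `V = ⊕_{μ ∈ P} V_μ`
with endomorphisms `f il` for `(i,l) ∈ I^∞ = I × ℤ_{>0}`. -/
structure WeakLowerPerfectSpace (k I P V : Type*) [Field k] [AddCommGroup P]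
    [AddCommGroup V] [Module k V] where
  /-- the simple roots `α_i` -/
  alpha : I → P
  alpha_indep : LinearIndependent ℤ alpha
  /-- `P` is a free abelian group -/
  free : Module.Free ℤ P
  /-- the weight spaces `V_μ` -/
  weight : P → Submodule k V
  weight_indep : iSupIndep weight
  weight_sup : ⨆ μ : P, weight μ = ⊤
  /-- the endomorphisms `f_{il}` -/
  f : I × ℕ+ → Module.End k V
  finiteDim : ∀ μ : P, Module.Finite k (weight μ)
  support_bounded : ∃ s : Finset P, ∀ μ : P, weight μ ≠ ⊥ →
    ∃ lam ∈ s, lam - μ ∈ AddSubmonoid.closure (Set.range alpha)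
  f_weight : ∀ (i : I) (l : ℕ+) (μ : P),
    (weight μ).map (f (i, l)) ≤ weight (μ - (l : ℕ) • alpha i)

namespace WeakLowerPerfectSpace

variable {k I P V : Type*} [Field k] [AddCommGroup P] [AddCommGroup V] [Module k V]

/-- `d il v` is the unique `n` with `v ∈ f_{il}^n V \ f_{il}^{n+1} V` (for `v ≠ 0`),
realized as the largest `n` with `v ∈ f_{il}^n V`. -/
noncomputable def d (S : WeakLowerPerfectSpace k I P V) (il : I × ℕ+) (v : V) : ℕ :=
  sSup {n : ℕ | v ∈ LinearMap.range (S.f il ^ n)}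

end WeakLowerPerfectSpace

/-- A lower perfect basis `B` of a weak lower perfect space, with structure maps
`F il : B → B ∪ {0}` (extended by `F il 0 = 0`). -/
structure LowerPerfectBasis {k I P V : Type*} [Field k] [AddCommGroup P]
    [AddCommGroup V] [Module k V] (S : WeakLowerPerfectSpace k I P V) (B : Set V) where
  indep : LinearIndependent k (fun b : B => (b : V))
  spans : Submodule.span k B = ⊤
  graded : ∀ b ∈ B, ∃ μ : P, b ∈ S.weight μ
  /-- the structure map `𝐟_{il}` -/
  F : I × ℕ+ → V → V
  F_zero : ∀ il : I × ℕ+, F il 0 = 0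
  F_mem : ∀ il : I × ℕ+, ∀ b ∈ B, F il b ∈ B ∪ {0}
  F_approx : ∀ il : I × ℕ+, ∀ b ∈ B, ∃ c : kˣ,
    S.f il b - (c : k) • F il b ∈ LinearMap.range (S.f il ^ (S.d il b + 2))
  F_inj : ∀ b ∈ B, ∀ b' ∈ B, (∀ il : I × ℕ+, F il b = F il b') → b = b'

namespace WeakLowerPerfectSpace

variable {k I P V : Type*} [Field k] [AddCommGroup P] [AddCommGroup V] [Module k V]

/-- The subspace `Σ_{(i,l) ∈ I^∞} f_{il} V`. -/
noncomputable def rad (S : WeakLowerPerfectSpace k I P V) : Submodule k V :=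
  ⨆ il : I × ℕ+, LinearMap.range (S.f il)

/-- The highest core `B_H = {b ∈ B | d_{il}(b) = 0 for all (i,l) ∈ I^∞}`. -/
def highestCore (S : WeakLowerPerfectSpace k I P V) (B : Set V) : Set V :=
  {b | b ∈ B ∧ ∀ il : I × ℕ+, S.d il b = 0}

end WeakLowerPerfectSpace

/-- Iterated application `𝐟_{i_1 l_1}^{a_1} ⋯ 𝐟_{i_r l_r}^{a_r}(b)` (rightmost factor applied
first): `fComp F seq a r b = F_{seq 0}^{a 0} (⋯ (F_{seq (r-1)}^{a (r-1)} b))`. -/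
def fComp {V ι : Type*} (F : ι → V → V) (seq : ℕ → ι) (a : ℕ → ℕ) : ℕ → V → V
  | 0, v => v
  | m + 1, v => fComp F seq a m ((F (seq m))^[a m] v)

/-- Iterated application `𝐞_{i_r l_r}^{a_r} ⋯ 𝐞_{i_1 l_1}^{a_1}(b)` (leftmost index applied
first): `eComp E seq a r b = E_{seq (r-1)}^{a (r-1)} (⋯ (E_{seq 0}^{a 0} b))`. -/
def eComp {V ι : Type*} (E : ι → V → V) (seq : ℕ → ι) (a : ℕ → ℕ) : ℕ → V → V
  | 0, v => v
  | m + 1, v => (E (seq m))^[a m] (eComp E seq a m v)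

/-- The sequence `b_0 = b`, `b_{k+1} = 𝐞_{i_{k+1} l_{k+1}}^{d_{i_{k+1} l_{k+1}}(b_k)}(b_k)`. -/
def bseq {V ι : Type*} (E : ι → V → V) (d : ι → V → ℕ) (seq : ℕ → ι) (b : V) : ℕ → V
  | 0 => b
  | m + 1 => (E (seq m))^[d (seq m) (bseq E d seq b m)] (bseq E d seq b m)

/-- The lexicographic strict order on sequences of non-negative integers. -/
def SeqLt (a a' : ℕ → ℕ) : Prop :=
  ∃ m : ℕ, (∀ s < m, a s = a' s) ∧ a m < a' m

/-- The lexicographic order on sequences of non-negative integers. -/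
def SeqLe (a a' : ℕ → ℕ) : Prop := a = a' ∨ SeqLt a a'

namespace WeakLowerPerfectSpace

variable {k I P V : Type*} [Field k] [AddCommGroup P] [AddCommGroup V] [Module k V]

/-- The composite `f_{i_1 l_1}^{a_1} ⋯ f_{i_m l_m}^{a_m}` (as an endomorphism, the
rightmost factor acting first). -/
noncomputable def pprod (S : WeakLowerPerfectSpace k I P V) (seq : ℕ → I × ℕ+)
    (a : ℕ → ℕ) (m : ℕ) : Module.End k V :=
  ((List.range m).map fun j => S.f (seq j) ^ a j).prod

/-- The subspace `V^{>i,a} = Σ_{k=1}^r f_{i_1l_1}^{a_1}⋯f_{i_{k−1}l_{k−1}}^{a_{k−1}} f_{i_kl_k}^{a_k+1} V`. -/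
noncomputable def Vgt (S : WeakLowerPerfectSpace k I P V) (seq : ℕ → I × ℕ+)
    (a : ℕ → ℕ) (r : ℕ) : Submodule k V :=
  ⨆ m : Fin r, LinearMap.range (S.pprod seq a (m : ℕ) * S.f (seq (m : ℕ)) ^ (a (m : ℕ) + 1))

/-- The subspace `V^{≥i,a} = V^{>i,a} + f_{i_1l_1}^{a_1}⋯f_{i_rl_r}^{a_r} V`. -/
noncomputable def Vge (S : WeakLowerPerfectSpace k I P V) (seq : ℕ → I × ℕ+)
    (a : ℕ → ℕ) (r : ℕ) : Submodule k V :=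
  S.Vgt seq a r ⊔ LinearMap.range (S.pprod seq a r)

end WeakLowerPerfectSpace

namespace WeakLowerPerfectSpace

variable {k I P V : Type*} [Field k] [AddCommGroup P] [AddCommGroup V] [Module k V]
  (S : WeakLowerPerfectSpace k I P V)

open scoped Classical in
theorem isInternal : DirectSum.IsInternal S.weight :=
  DirectSum.isInternal_submodule_of_iSupIndep_of_iSup_eq_top S.weight_indep S.weight_sup

open scoped Classical in
/-- The projection of `V = ⊕ V_μ` onto the weight space `V_μ`. -/
noncomputable def weightProj (μ : P) : Module.End k V :=
  (S.weight μ).subtype ∘ₗ DirectSum.component k P (fun ν => S.weight ν) μ ∘ₗ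
    (LinearEquiv.ofBijective (DirectSum.coeLinearMap S.weight) S.isInternal).symm.toLinearMap

theorem weightProj_mem (μ : P) (v : V) : S.weightProj μ v ∈ S.weight μ :=
  Submodule.coe_mem _

theorem weightProj_of_mem {μ : P} {v : V} (hv : v ∈ S.weight μ) : S.weightProj μ v = v := by
  classical
  exact congrArg Subtype.val (S.isInternal.ofBijective_coeLinearMap_of_mem hv)

theorem weightProj_of_ne {μ ν : P} (h : μ ≠ ν) {v : V} (hv : v ∈ S.weight ν) :
    S.weightProj μ v = 0 := by
  classical
  exact congrArg Subtype.val (S.isInternal.ofBijective_coeLinearMap_of_ne h.symm ⟨v, hv⟩)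

theorem mem_of_weightProj_mem {U : Submodule k V} {v : V} (h : ∀ μ, S.weightProj μ v ∈ U) :
    v ∈ U := by
  classical
  set e := LinearEquiv.ofBijective (DirectSum.coeLinearMap S.weight) S.isInternal
  have hv : DirectSum.coeLinearMap S.weight (e.symm v) = v := e.apply_symm_apply v
  rw [← hv, DirectSum.coeLinearMap_eq_dfinsuppSum]
  exact Submodule.sum_mem _ fun μ _ => h μ

theorem weightProj_f (il : I × ℕ+) (μ : P) (v : V) :
    S.weightProj μ (S.f il v) = S.f il (S.weightProj (μ + (il.2 : ℕ) • S.alpha il.1) v) := by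
  have hv : v ∈ ⨆ ν : P, S.weight ν := S.weight_sup ▸ Submodule.mem_top
  induction hv using Submodule.iSup_induction' with
  | mem ν x hx =>
    have hfx : S.f il x ∈ S.weight (ν - (il.2 : ℕ) • S.alpha il.1) :=
      S.f_weight il.1 il.2 ν (Submodule.mem_map_of_mem hx)
    by_cases h : μ + (il.2 : ℕ) • S.alpha il.1 = ν
    · subst h
      rw [S.weightProj_of_mem hx, S.weightProj_of_mem (by simpa using hfx)]
    · rw [S.weightProj_of_ne h hx, map_zero, S.weightProj_of_ne _ hfx]
      exact fun h' => h (by rw [h', sub_add_cancel])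
  | zero => simp
  | add x y _ _ hx hy => simp [hx, hy]

theorem weightProj_f_pow (il : I × ℕ+) (n : ℕ) (μ : P) (v : V) :
    S.weightProj μ ((S.f il ^ n) v) =
      (S.f il ^ n) (S.weightProj (μ + (n * il.2 : ℕ) • S.alpha il.1) v) := by
  induction n generalizing μ with
  | zero => simp
  | succ n ih =>
    rw [pow_succ', Module.End.mul_apply, weightProj_f, ih, Module.End.mul_apply, add_assoc,
      ← add_smul]
    congr 6
    ring

theorem exists_add_nsmul_notMem_closure (lam μ : P) (i : I) (l : ℕ+) :
    ∃ N : ℕ, ∀ n ≥ N, lam - (μ + (n * l : ℕ) • S.alpha i) ∉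
      AddSubmonoid.closure (Set.range S.alpha) := by
  by_cases h : ∃ n : ℕ, lam - (μ + (n * l : ℕ) • S.alpha i) ∈
      AddSubmonoid.closure (Set.range S.alpha)
  · obtain ⟨n₀, h₀⟩ := h
    obtain ⟨c₀, hc₀⟩ := AddSubmonoid.mem_closure_range_iff.mp h₀
    refine ⟨n₀ + c₀ i + 1, fun n hn hmem => ?_⟩
    obtain ⟨c, hc⟩ := AddSubmonoid.mem_closure_range_iff.mp hmem
    have hindep : LinearIndependent ℕ S.alpha :=
      S.alpha_indep.restrict_scalars (R := ℕ) fun m n h => by simpa using h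
    have heq : c + Finsupp.single i (n * l : ℕ) = c₀ + Finsupp.single i (n₀ * l : ℕ) := by
      apply hindep
      simp only [map_add, Finsupp.linearCombination_single]
      rw [Finsupp.linearCombination_apply, Finsupp.linearCombination_apply, ← hc, ← hc₀]
      abel
    have hi := DFunLike.congr_fun heq i
    simp only [Finsupp.add_apply, Finsupp.single_eq_same] at hi
    nlinarith [l.pos, Nat.zero_le (c i)]
  · push Not at h
    exact ⟨0, fun n _ => h n⟩

theorem exists_weight_add_nsmul_eq_bot (μ : P) (il : I × ℕ+) :
    ∃ N : ℕ, ∀ n ≥ N, S.weight (μ + (n * il.2 : ℕ) • S.alpha il.1) = ⊥ := by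
  obtain ⟨s, hs⟩ := S.support_bounded
  choose N hN using fun lam => S.exists_add_nsmul_notMem_closure lam μ il.1 il.2
  refine ⟨s.sup N, fun n hn => by_contra fun h => ?_⟩
  obtain ⟨lam, hlam, hmem⟩ := hs _ h
  exact hN lam n ((Finset.le_sup hlam).trans hn) hmem

theorem exists_weightProj_eq_zero (μ : P) (il : I × ℕ+) :
    ∃ N : ℕ, ∀ n ≥ N, ∀ v ∈ LinearMap.range (S.f il ^ n), S.weightProj μ v = 0 := by
  obtain ⟨N, hN⟩ := S.exists_weight_add_nsmul_eq_bot μ il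
  refine ⟨N, fun n hn v hv => ?_⟩
  obtain ⟨w, rfl⟩ := hv
  have h := S.weightProj_mem (μ + (n * il.2 : ℕ) • S.alpha il.1) w
  rw [hN n hn, Submodule.mem_bot] at h
  rw [weightProj_f_pow, h, map_zero]

theorem range_f_pow_antitone (il : I × ℕ+) :
    Antitone fun n => LinearMap.range (S.f il ^ n) := fun m n h => by
  obtain ⟨j, rfl⟩ := Nat.exists_eq_add_of_le h
  dsimp only
  rw [pow_add]
  exact LinearMap.range_comp_le_range _ _

theorem f_mem_range_pow {il : I × ℕ+} {n : ℕ} {v : V} (hv : v ∈ LinearMap.range (S.f il ^ n)) :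
    S.f il v ∈ LinearMap.range (S.f il ^ (n + 1)) := by
  obtain ⟨w, rfl⟩ := hv
  exact ⟨w, by rw [pow_succ', Module.End.mul_apply]⟩

/-- A nonzero weight vector lies in `f_{il}^n V` exactly when `n ≤ d_{il}`. -/
theorem mem_range_f_pow_iff {μ : P} {v : V} (hv : v ∈ S.weight μ) (h0 : v ≠ 0) (il : I × ℕ+)
    (n : ℕ) : v ∈ LinearMap.range (S.f il ^ n) ↔ n ≤ S.d il v := by
  obtain ⟨N, hN⟩ := S.exists_weightProj_eq_zero μ il
  have hbdd : BddAbove {n : ℕ | v ∈ LinearMap.range (S.f il ^ n)} :=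
    ⟨N, fun n hn => by_contra fun h =>
      h0 (S.weightProj_of_mem hv ▸ hN n (not_le.mp h).le v hn)⟩
  refine ⟨fun h => le_csSup hbdd h, fun h => S.range_f_pow_antitone il h ?_⟩
  exact Nat.sSup_mem ⟨0, by simp⟩ hbdd

end WeakLowerPerfectSpace

namespace LowerPerfectBasis

variable {k I P V : Type*} [Field k] [AddCommGroup P] [AddCommGroup V] [Module k V]
  {S : WeakLowerPerfectSpace k I P V} {B : Set V} (LB : LowerPerfectBasis S B)

include LB in
theorem ne_zero {b : V} (hb : b ∈ B) : b ≠ 0 :=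
  LB.indep.ne_zero ⟨b, hb⟩

include LB in
theorem mem_of_mem_span {T : Set V} (hT : T ⊆ B) {b : V} (hb : b ∈ B)
    (h : b ∈ Submodule.span k T) : b ∈ T := by
  have hB : LinearIndepOn k id B := LB.indep
  exact (hB.mono hT).mem_span_iff_id.mp h (hB.mono (Set.insert_subset hb hT))

include LB in
theorem weightProj_mem_span {T : Set V} (hT : T ⊆ B) (μ : P) {v : V}
    (h : v ∈ Submodule.span k T) : S.weightProj μ v ∈ Submodule.span k T := by
  induction h using Submodule.span_induction with
  | mem x hx =>
    obtain ⟨ν, hν⟩ := LB.graded x (hT hx)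
    by_cases h : μ = ν
    · subst h
      rw [S.weightProj_of_mem hν]
      exact Submodule.subset_span hx
    · rw [S.weightProj_of_ne h hν]
      exact Submodule.zero_mem _
  | zero => simp
  | add x y _ _ hx hy => exact map_add (S.weightProj μ) x y ▸ Submodule.add_mem _ hx hy
  | smul c x _ hx => exact map_smul (S.weightProj μ) c x ▸ Submodule.smul_mem _ c hx

include LB in
theorem mem_range_f_pow_iff {b : V} (hb : b ∈ B) (il : I × ℕ+) (n : ℕ) :
    b ∈ LinearMap.range (S.f il ^ n) ↔ n ≤ S.d il b := by
  obtain ⟨μ, hμ⟩ := LB.graded b hb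
  exact S.mem_range_f_pow_iff hμ (LB.ne_zero hb) il n

theorem F_mem_range {b : V} (hb : b ∈ B) (il : I × ℕ+) :
    LB.F il b ∈ LinearMap.range (S.f il ^ (S.d il b + 1)) := by
  obtain ⟨c, hc⟩ := LB.F_approx il b hb
  have h1 := S.f_mem_range_pow ((LB.mem_range_f_pow_iff hb il _).mpr le_rfl)
  have h2 := Submodule.sub_mem _ h1 (S.range_f_pow_antitone il (Nat.le_succ _) hc)
  rw [sub_sub_cancel] at h2
  exact (Submodule.smul_mem_iff _ c.ne_zero).mp h2

theorem F_ne_zero_mem {b : V} (hb : b ∈ B) {il : I × ℕ+} (h : LB.F il b ≠ 0) : LB.F il b ∈ B :=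
  (LB.F_mem il b hb).resolve_right h

/-- On the basis elements in `f_{il}^n V`, the maps `f_{il}` and `𝐟_{il}` agree up to units modulo
`f_{il}^{n+2} V`. -/
theorem map_span_le {il : I × ℕ+} {n : ℕ} :
    (Submodule.span k (B ∩ LinearMap.range (S.f il ^ n) : Set V)).map (S.f il) ≤
      Submodule.span k {x | x ∈ B ∧ ∃ b ∈ B, n ≤ S.d il b ∧ LB.F il b = x} ⊔
        LinearMap.range (S.f il ^ (n + 2)) := by
  rw [Submodule.map_span, Submodule.span_le]
  rintro _ ⟨b, ⟨hb, hbn⟩, rfl⟩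
  have hn : n ≤ S.d il b := (LB.mem_range_f_pow_iff hb il n).mp hbn
  obtain ⟨c, hc⟩ := LB.F_approx il b hb
  rw [← sub_add_cancel (S.f il b) ((c : k) • LB.F il b), add_comm (_ - _)]
  refine Submodule.add_mem_sup (Submodule.smul_mem _ _ ?_)
    (S.range_f_pow_antitone il (by omega : n + 2 ≤ _) hc)
  by_cases h0 : LB.F il b = 0
  · exact h0 ▸ Submodule.zero_mem _
  · exact Submodule.subset_span ⟨LB.F_ne_zero_mem hb h0, b, hb, hn, rfl⟩

include LB in
theorem range_le_span_sup (il : I × ℕ+) (n : ℕ) :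
    LinearMap.range (S.f il ^ n) ≤
      Submodule.span k (B ∩ LinearMap.range (S.f il ^ n) : Set V) ⊔
        LinearMap.range (S.f il ^ (n + 1)) := by
  induction n with
  | zero => simp [Module.End.one_eq_id, LB.spans]
  | succ n ih =>
    have h := Submodule.map_mono (f := S.f il) ih
    rw [Submodule.map_sup, ← LinearMap.range_comp, ← LinearMap.range_comp,
      ← Module.End.mul_eq_comp, ← Module.End.mul_eq_comp, ← pow_succ', ← pow_succ'] at h
    refine h.trans (sup_le (LB.map_span_le.trans (sup_le_sup_right (Submodule.span_mono ?_) _))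
      le_sup_right)
    rintro _ ⟨hx, b, hb, hn, rfl⟩
    exact ⟨hx, S.range_f_pow_antitone il (Nat.succ_le_succ hn) (LB.F_mem_range hb il)⟩

include LB in
theorem range_le_span_sup_add (il : I × ℕ+) (n N : ℕ) :
    LinearMap.range (S.f il ^ n) ≤
      Submodule.span k (B ∩ LinearMap.range (S.f il ^ n) : Set V) ⊔
        LinearMap.range (S.f il ^ (n + N)) := by
  induction N with
  | zero => exact le_sup_right
  | succ N ih =>
    refine ih.trans (sup_le le_sup_left ((LB.range_le_span_sup il (n + N)).trans
      (sup_le_sup_right (Submodule.span_mono (Set.inter_subset_inter_right _ ?_)) _)))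
    exact S.range_f_pow_antitone il (Nat.le_add_right n N)

include LB in
/-- The subspace `f_{il}^n V` is spanned by the basis elements it contains. -/
theorem range_le_span (il : I × ℕ+) (n : ℕ) :
    LinearMap.range (S.f il ^ n) ≤
      Submodule.span k (B ∩ LinearMap.range (S.f il ^ n) : Set V) := by
  intro v hv
  refine S.mem_of_weightProj_mem fun μ => ?_
  obtain ⟨N, hN⟩ := S.exists_weightProj_eq_zero μ il
  obtain ⟨x, hx, y, hy, rfl⟩ := Submodule.mem_sup.mp (LB.range_le_span_sup_add il n N hv)
  rw [map_add, hN _ (Nat.le_add_left N n) y hy, add_zero]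
  exact LB.weightProj_mem_span Set.inter_subset_left μ hx

include LB in
theorem mem_or_mem_of_mem_sup {T : Set V} (hT : T ⊆ B) {b : V} (hb : b ∈ B) {il : I × ℕ+} {n : ℕ}
    (h : b ∈ Submodule.span k T ⊔ LinearMap.range (S.f il ^ n)) :
    b ∈ T ∨ b ∈ LinearMap.range (S.f il ^ n) := by
  have h' := sup_le_sup_left (LB.range_le_span il n) _ h
  rw [← Submodule.span_union] at h'
  exact (LB.mem_of_mem_span (Set.union_subset hT Set.inter_subset_left) hb h').imp_right And.right

theorem exists_F_eq {b : V} (hb : b ∈ B) {il : I × ℕ+} (hd : 0 < S.d il b) :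
    ∃ b' ∈ B, LB.F il b' = b ∧ S.d il b' + 1 = S.d il b := by
  obtain ⟨m, hm⟩ := Nat.exists_eq_add_of_lt hd
  rw [zero_add] at hm
  obtain ⟨w, hw⟩ := (LB.mem_range_f_pow_iff hb il (m + 1)).mpr hm.ge
  rw [pow_succ', Module.End.mul_apply] at hw
  have hmem := LB.map_span_le (hw ▸ Submodule.mem_map_of_mem (LB.range_le_span il m ⟨w, rfl⟩))
  rcases LB.mem_or_mem_of_mem_sup (fun _ h => h.1) hb hmem with ⟨-, b', hb', hn, rfl⟩ | h
  · have := (LB.mem_range_f_pow_iff hb il _).mp (LB.F_mem_range hb' il)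
    exact ⟨b', hb', rfl, by omega⟩
  · have := (LB.mem_range_f_pow_iff hb il _).mp h
    omega

theorem iterate_F_mem {b : V} (hb : b ∈ B) (il : I × ℕ+) (n : ℕ) :
    (LB.F il)^[n] b ∈ B ∪ {0} := by
  induction n with
  | zero => exact Or.inl hb
  | succ n ih =>
    rw [Function.iterate_succ_apply']
    rcases ih with h | h
    · exact LB.F_mem il _ h
    · exact Or.inr ((congrArg _ h).trans (LB.F_zero il))

theorem iterate_F_mem_range {b : V} (hb : b ∈ B) (il : I × ℕ+) (n : ℕ) :
    (LB.F il)^[n] b ∈ LinearMap.range (S.f il ^ (S.d il b + n)) := by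
  induction n with
  | zero => exact (LB.mem_range_f_pow_iff hb il _).mpr le_rfl
  | succ n ih =>
    rw [Function.iterate_succ_apply']
    rcases LB.iterate_F_mem hb il n with h | h
    · have := (LB.mem_range_f_pow_iff h il _).mp ih
      exact S.range_f_pow_antitone il (by omega) (LB.F_mem_range h il)
    · rw [Set.mem_singleton_iff.mp h, LB.F_zero]
      exact Submodule.zero_mem _

theorem f_pow_approx {b : V} (hb : b ∈ B) (il : I × ℕ+) (n : ℕ) :
    ∃ c : kˣ, (S.f il ^ n) b - (c : k) • (LB.F il)^[n] b ∈
      LinearMap.range (S.f il ^ (S.d il b + n + 1)) := by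
  induction n with
  | zero => exact ⟨1, by simp⟩
  | succ n ih =>
    obtain ⟨c, hc⟩ := ih
    obtain ⟨c', hc'⟩ : ∃ c' : kˣ,
        S.f il ((LB.F il)^[n] b) - (c' : k) • LB.F il ((LB.F il)^[n] b) ∈
          LinearMap.range (S.f il ^ (S.d il b + n + 2)) := by
      rcases LB.iterate_F_mem hb il n with h | h
      · obtain ⟨c', hc'⟩ := LB.F_approx il _ h
        have := (LB.mem_range_f_pow_iff h il _).mp (LB.iterate_F_mem_range hb il n)
        exact ⟨c', S.range_f_pow_antitone il (by omega) hc'⟩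
      · rw [Set.mem_singleton_iff.mp h, LB.F_zero]
        exact ⟨1, by simp⟩
    refine ⟨c * c', ?_⟩
    have h := Submodule.add_mem _ (S.f_mem_range_pow hc) (Submodule.smul_mem _ (c : k) hc')
    rw [map_sub, map_smul, smul_sub, sub_add_sub_cancel, smul_smul, ← Module.End.mul_apply,
      ← pow_succ', ← Function.iterate_succ_apply' (LB.F il)] at h
    exact h

theorem iterate_F_mem_map_sup {U : Submodule k V} {b : V} (hb : b ∈ B) (hU : b ∈ U)
    (il : I × ℕ+) (n : ℕ) :
    (LB.F il)^[n] b ∈ U.map (S.f il ^ n) ⊔ LinearMap.range (S.f il ^ (n + 1)) := by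
  obtain ⟨c, hc⟩ := LB.f_pow_approx hb il n
  have h := Submodule.sub_mem _
    (Submodule.mem_sup_left (Submodule.mem_map_of_mem (f := S.f il ^ n) hU))
    (Submodule.mem_sup_right (S.range_f_pow_antitone il (by omega : n + 1 ≤ _) hc))
  rw [sub_sub_cancel] at h
  exact (Submodule.smul_mem_iff _ c.ne_zero).mp h

theorem map_sup_le_span_sup {U : Submodule k V} (hU : U ≤ Submodule.span k (B ∩ U : Set V))
    (il : I × ℕ+) (n : ℕ) :
    U.map (S.f il ^ n) ⊔ LinearMap.range (S.f il ^ (n + 1)) ≤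
      Submodule.span k {x | x ∈ B ∧ ∃ b ∈ B, b ∈ U ∧ (LB.F il)^[n] b = x} ⊔
        LinearMap.range (S.f il ^ (n + 1)) := by
  refine sup_le ((Submodule.map_mono hU).trans ?_) le_sup_right
  rw [Submodule.map_span, Submodule.span_le]
  rintro _ ⟨b, ⟨hb, hbU⟩, rfl⟩
  obtain ⟨c, hc⟩ := LB.f_pow_approx hb il n
  rw [← sub_add_cancel ((S.f il ^ n) b) ((c : k) • (LB.F il)^[n] b), add_comm (_ - _)]
  refine Submodule.add_mem_sup (Submodule.smul_mem _ _ ?_)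
    (S.range_f_pow_antitone il (by omega : n + 1 ≤ _) hc)
  rcases LB.iterate_F_mem hb il n with h | h
  · exact Submodule.subset_span ⟨h, b, hb, hbU, rfl⟩
  · exact Set.mem_singleton_iff.mp h ▸ Submodule.zero_mem _

include LB in
theorem map_sup_le_span {U : Submodule k V} (hU : U ≤ Submodule.span k (B ∩ U : Set V))
    (il : I × ℕ+) (n : ℕ) :
    U.map (S.f il ^ n) ⊔ LinearMap.range (S.f il ^ (n + 1)) ≤
      Submodule.span k (B ∩ (U.map (S.f il ^ n) ⊔ LinearMap.range (S.f il ^ (n + 1)) :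
        Submodule k V) : Set V) := by
  refine (LB.map_sup_le_span_sup hU il n).trans (sup_le (Submodule.span_mono ?_)
    ((LB.range_le_span il (n + 1)).trans
      (Submodule.span_mono (Set.inter_subset_inter_right _ fun _ h => Submodule.mem_sup_right h))))
  rintro _ ⟨hx, b, hb, hbU, rfl⟩
  exact ⟨hx, LB.iterate_F_mem_map_sup hb hbU il n⟩

section Raising

variable {E : I × ℕ+ → V → V}
  (hE : ∀ il : I × ℕ+, ∀ b ∈ B, ∀ b' ∈ B, LB.F il b' = b → E il b = b')

include hE

theorem iterate_E_spec {b : V} (hb : b ∈ B) {il : I × ℕ+} {n : ℕ} (hn : n ≤ S.d il b) :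
    (E il)^[n] b ∈ B ∧ (LB.F il)^[n] ((E il)^[n] b) = b ∧ S.d il ((E il)^[n] b) + n = S.d il b := by
  induction n with
  | zero => exact ⟨hb, rfl, rfl⟩
  | succ n ih =>
    obtain ⟨hB, hF, hd⟩ := ih (by omega)
    obtain ⟨b', hb', hFb', hdb'⟩ := LB.exists_F_eq hB (il := il) (by omega)
    rw [Function.iterate_succ_apply', Function.iterate_succ_apply, hE il _ hB b' hb' hFb', hFb']
    exact ⟨hb', hF, by omega⟩

theorem iterate_E_iterate_F {b : V} (hb : b ∈ B) {il : I × ℕ+} {n : ℕ}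
    (h : (LB.F il)^[n] b ∈ B) : (E il)^[n] ((LB.F il)^[n] b) = b := by
  induction n with
  | zero => rfl
  | succ n ih =>
    have hn : (LB.F il)^[n] b ∈ B := by
      refine (LB.iterate_F_mem hb il n).resolve_right fun h0 => LB.ne_zero h ?_
      rw [Function.iterate_succ_apply', Set.mem_singleton_iff.mp h0, LB.F_zero]
    rw [Function.iterate_succ_apply,
      hE il _ h _ hn (Function.iterate_succ_apply' _ _ _).symm]
    exact ih hn

theorem iterate_E_mem_of_mem_map_sup {U : Submodule k V}
    (hU : U ≤ Submodule.span k (B ∩ U : Set V)) {b : V} (hb : b ∈ B) (il : I × ℕ+)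
    (h : b ∈ U.map (S.f il ^ S.d il b) ⊔ LinearMap.range (S.f il ^ (S.d il b + 1))) :
    (E il)^[S.d il b] b ∈ U := by
  rcases LB.mem_or_mem_of_mem_sup (fun _ h => h.1) hb (LB.map_sup_le_span_sup hU il _ h) with
    ⟨-, b', hb', hbU, hF⟩ | h
  · have h' := LB.iterate_E_iterate_F hE hb' (hF ▸ hb)
    rw [hF] at h'
    rwa [h']
  · have := (LB.mem_range_f_pow_iff hb il _).mp h
    omega

theorem mem_map_sup_of_iterate_E_mem {U : Submodule k V} {b : V} (hb : b ∈ B) (il : I × ℕ+)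
    (h : (E il)^[S.d il b] b ∈ U) :
    b ∈ U.map (S.f il ^ S.d il b) ⊔ LinearMap.range (S.f il ^ (S.d il b + 1)) := by
  obtain ⟨hB, hF, -⟩ := LB.iterate_E_spec hE hb (il := il) le_rfl
  simpa only [hF] using LB.iterate_F_mem_map_sup hB h il (S.d il b)

end Raising

end LowerPerfectBasis

theorem bseq_succ {V ι : Type*} (E : ι → V → V) (d : ι → V → ℕ) (seq : ℕ → ι) (b : V) (m : ℕ) :
    bseq E d seq b (m + 1) =
      bseq E d (fun n => seq (n + 1)) ((E (seq 0))^[d (seq 0) b] b) m := by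
  induction m with
  | zero => rfl
  | succ m ih => rw [bseq, ih, bseq]

namespace WeakLowerPerfectSpace

variable {k I P V : Type*} [Field k] [AddCommGroup P] [AddCommGroup V] [Module k V]
  (S : WeakLowerPerfectSpace k I P V)

theorem pprod_succ (seq : ℕ → I × ℕ+) (a : ℕ → ℕ) (m : ℕ) :
    S.pprod seq a (m + 1) =
      S.f (seq 0) ^ a 0 * S.pprod (fun n => seq (n + 1)) (fun n => a (n + 1)) m := by
  simp [pprod, List.range_succ_eq_map, Function.comp_def]

theorem Vge_zero (seq : ℕ → I × ℕ+) (a : ℕ → ℕ) : S.Vge seq a 0 = ⊤ := by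
  simp [Vge, pprod, Module.End.one_eq_id]

theorem Vge_succ (seq : ℕ → I × ℕ+) (a : ℕ → ℕ) (r : ℕ) :
    S.Vge seq a (r + 1) =
      (S.Vge (fun n => seq (n + 1)) (fun n => a (n + 1)) r).map (S.f (seq 0) ^ a 0) ⊔
        LinearMap.range (S.f (seq 0) ^ (a 0 + 1)) := by
  have hsup : ∀ g : Fin (r + 1) → Submodule k V, ⨆ m, g m = g 0 ⊔ ⨆ m : Fin r, g m.succ :=
    fun g => le_antisymm
      (iSup_le fun m => Fin.cases le_sup_left
        (fun j => le_sup_of_le_right (le_iSup (fun j : Fin r => g j.succ) j)) m)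
      (sup_le (le_iSup g 0) (iSup_le fun j => le_iSup g j.succ))
  have h0 : S.pprod seq a 0 = 1 := by simp [pprod]
  simp only [Vge, Vgt, hsup, Fin.val_zero, Fin.val_succ, pprod_succ, h0, one_mul, mul_assoc,
    Submodule.map_sup, Submodule.map_iSup]
  simp only [Module.End.mul_eq_comp, LinearMap.range_comp]
  rw [sup_assoc, sup_comm]

end WeakLowerPerfectSpace

namespace LowerPerfectBasis

variable {k I P V : Type*} [Field k] [AddCommGroup P] [AddCommGroup V] [Module k V]
  {S : WeakLowerPerfectSpace k I P V} {B : Set V} (LB : LowerPerfectBasis S B)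

include LB in
/-- The subspace `V^{≥i,a}` is spanned by the basis elements it contains. -/
theorem Vge_le_span (seq : ℕ → I × ℕ+) (a : ℕ → ℕ) (r : ℕ) :
    S.Vge seq a r ≤ Submodule.span k (B ∩ S.Vge seq a r : Set V) := by
  induction r generalizing seq a with
  | zero => simp [S.Vge_zero, LB.spans]
  | succ r ih =>
    rw [S.Vge_succ]
    exact LB.map_sup_le_span (ih _ _) _ _

variable {E : I × ℕ+ → V → V}
  (hE : ∀ il : I × ℕ+, ∀ b ∈ B, ∀ b' ∈ B, LB.F il b' = b → E il b = b')

include hE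

theorem mem_Vge_bseq (seq : ℕ → I × ℕ+) {b : V} (hb : b ∈ B) (r : ℕ) :
    b ∈ S.Vge seq (fun m => S.d (seq m) (bseq E S.d seq b m)) r := by
  induction r generalizing seq b with
  | zero => simp [S.Vge_zero]
  | succ r ih =>
    rw [S.Vge_succ]
    refine LB.mem_map_sup_of_iterate_E_mem hE hb (seq 0) ?_
    simp only [bseq_succ]
    exact ih _ (LB.iterate_E_spec hE hb le_rfl).1

theorem eq_or_seqLt_of_mem_Vge (seq : ℕ → I × ℕ+) (a : ℕ → ℕ) {b : V} (hb : b ∈ B) (r : ℕ)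
    (h : b ∈ S.Vge seq a r) :
    (∀ s < r, a s = S.d (seq s) (bseq E S.d seq b s)) ∨
      SeqLt a fun m => S.d (seq m) (bseq E S.d seq b m) := by
  induction r generalizing seq a b with
  | zero => exact Or.inl fun s hs => absurd hs (Nat.not_lt_zero s)
  | succ r ih =>
    rw [S.Vge_succ] at h
    have hle : a 0 ≤ S.d (seq 0) b := by
      refine (LB.mem_range_f_pow_iff hb (seq 0) (a 0)).mp (sup_le LinearMap.map_le_range
        (S.range_f_pow_antitone (seq 0) (Nat.le_succ _)) h)
    rcases hle.lt_or_eq with hlt | heq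
    · exact Or.inr ⟨0, fun s hs => absurd hs (Nat.not_lt_zero s), hlt⟩
    · rw [heq] at h
      have hmem := LB.iterate_E_mem_of_mem_map_sup hE (LB.Vge_le_span _ _ r) hb (seq 0) h
      rcases ih _ _ (LB.iterate_E_spec hE hb le_rfl).1 hmem with h' | ⟨m, hm, hlt⟩
      · refine Or.inl fun s hs => ?_
        cases s with
        | zero => exact heq
        | succ s => rw [bseq_succ]; exact h' s (by omega)
      · refine Or.inr ⟨m + 1, fun s hs => ?_, ?_⟩
        · cases s with
          | zero => exact heq
          | succ s => simp only [bseq_succ]; exact hm s (by omega)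
        · simp only [bseq_succ]; exact hlt

end LowerPerfectBasis

/-- A sequence supported on `[0, r)` is lexicographically at most any sequence agreeing with it
there. -/
theorem seqLe_of_eqOn {a d : ℕ → ℕ} {r : ℕ} (ha : ∀ m ≥ r, a m = 0) (h : ∀ s < r, a s = d s) :
    SeqLe a d := by
  classical
  by_cases hne : ∃ m, a m ≠ d m
  · refine Or.inr ⟨Nat.find hne, fun s hs => not_not.mp (Nat.find_min hne hs), ?_⟩
    have hr : r ≤ Nat.find hne := not_lt.mp fun hlt => Nat.find_spec hne (h _ hlt)
    have := Nat.find_spec hne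
    rw [ha _ hr] at this ⊢
    omega
  · push Not at hne
    exact Or.inl (funext hne)

theorem stmt_7 {k I P V : Type*} [Field k] [AddCommGroup P] [AddCommGroup V] [Module k V]
    (S : WeakLowerPerfectSpace k I P V) (B : Set V) (LB : LowerPerfectBasis S B)
(E : I × ℕ+ → V → V)
    (hE0 : ∀ il : I × ℕ+, E il 0 = 0)
    (hEdef : ∀ il : I × ℕ+, ∀ b ∈ B, ∀ b' ∈ B, LB.F il b' = b → E il b = b')
    (hEnone : ∀ il : I × ℕ+, ∀ b ∈ B, (∀ b' ∈ B, LB.F il b' ≠ b) → E il b = 0)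
    (seq : ℕ → I × ℕ+) (hseq : ∀ p : I × ℕ+, ∀ N : ℕ, ∃ m ≥ N, seq m = p)
    (b : V) (hb : b ∈ B) :
    (∀ r : ℕ, (∀ m ≥ r, S.d (seq m) (bseq E S.d seq b m) = 0) →
      b ∈ S.Vge seq (fun m => S.d (seq m) (bseq E S.d seq b m)) r) ∧
    (∀ (a : ℕ → ℕ) (r : ℕ), (∀ m ≥ r, a m = 0) → b ∈ S.Vge seq a r →
      SeqLe a fun m => S.d (seq m) (bseq E S.d seq b m)) := by
  exact ⟨fun r _ => LB.mem_Vge_bseq hEdef seq hb r, fun a r ha h =>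
    (LB.eq_or_seqLt_of_mem_Vge hEdef seq a hb r h).elim (seqLe_of_eqOn ha) Or.inr⟩
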